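/- Define f_x(m,p) = C(x−m+p+α, m+β)·C(x+m−p+γ, p+δ), g_x(m,p) = C(x−m+p+α, m+β)·C(x+m−p−1+γ, p+δ), h_x(m,p) = C(x−m+p+α, m−1+β)·C(x+m−p−1+γ, p+δ) for fixed integer parameters α,β,γ,δ. Then these functions satisfy the recurrence system: f_{x+1}(m,p) = f_x(m,p) + f_x(m−1,p−1) + g_x(m,p−1) + g_x(m−1,p−1) + h_x(m,p) + h_x(m,p−1); g_{x+1}(m,p) = f_x(m,p) + g_x(m−1,p−1) + h_x(m,p); h_{x+1}(m,p) = f_x(m−1,p) + g_x(m−1,p−1) + h_x(m−1,p−1), for all integers x, m, p in the range where all binomial coefficients have nonnegative arguments. -/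

import Mathlib

open Finset

/-- Binomial coefficient on the integers, with `C a b = 0` unless `0 ≤ b ≤ a`. -/
def C (a b : ℤ) : ℚ := if 0 ≤ b ∧ b ≤ a then (Nat.choose a.toNat b.toNat : ℚ) else 0

def f (α β γ δ x m p : ℤ) : ℚ := C (x - m + p + α) (m + β) * C (x + m - p + γ) (p + δ)
def g (α β γ δ x m p : ℤ) : ℚ := C (x - m + p + α) (m + β) * C (x + m - p - 1 + γ) (p + δ)
def h (α β γ δ x m p : ℤ) : ℚ := C (x - m + p + α) (m - 1 + β) * C (x + m - p - 1 + γ) (p + δ)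

/-- The Pascal rule for the integer binomial, valid for nonnegative top entry. -/
lemma C_pascal (a b : ℤ) (ha : 0 ≤ a) : C (a + 1) b = C a b + C a (b - 1) := by
  have key : ∀ (n : ℕ) (k : ℤ), C n k = if 0 ≤ k then (Nat.choose n k.toNat : ℚ) else 0 := by
    intro n k
    unfold C
    by_cases hk : 0 ≤ k
    · by_cases hn : k ≤ n
      · simp [hk, hn]
      · have : n < k.toNat := by omega
        simp [hk, hn, Nat.choose_eq_zero_of_lt this]
    · simp [hk]
  obtain ⟨n, rfl⟩ := Int.eq_ofNat_of_zero_le ha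
  have e := key (n + 1) b
  push_cast at e
  rw [e, key, key]
  rcases lt_trichotomy b 0 with hb | rfl | hb
  · rw [if_neg (by omega), if_neg (by omega), if_neg (by omega)]; simp
  · simp
  · obtain ⟨k, hk⟩ : ∃ k : ℕ, b = (k : ℤ) + 1 := ⟨(b - 1).toNat, by omega⟩
    subst hk
    rw [if_pos (by omega), if_pos (by omega), if_pos (by omega)]
    have h1 : ((k : ℤ) + 1).toNat = k + 1 := by omega
    have h2 : ((k : ℤ) + 1 - 1).toNat = k := by omega
    rw [h1, h2, Nat.choose_succ_succ]
    push_cast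
    ring

theorem fgh_recurrence (α β γ δ x m p : ℤ)
    (h1 : 0 ≤ x - m + p + α - 1) (h2 : 0 ≤ x + m - p + γ - 1) :
    f α β γ δ (x + 1) m p =
        f α β γ δ x m p + f α β γ δ x (m - 1) (p - 1) + g α β γ δ x m (p - 1) +
          g α β γ δ x (m - 1) (p - 1) + h α β γ δ x m p + h α β γ δ x m (p - 1) ∧
    g α β γ δ (x + 1) m p =
        f α β γ δ x m p + g α β γ δ x (m - 1) (p - 1) + h α β γ δ x m p ∧
    h α β γ δ (x + 1) m p =
        f α β γ δ x (m - 1) p + g α β γ δ x (m - 1) (p - 1) + h α β γ δ x (m - 1) (p - 1) := by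
  obtain ⟨A, hA⟩ : ∃ A, A = x - m + p + α - 1 := ⟨_, rfl⟩
  obtain ⟨B, hB⟩ : ∃ B, B = x + m - p + γ - 1 := ⟨_, rfl⟩
  obtain ⟨k, hk⟩ : ∃ k, k = m + β := ⟨_, rfl⟩
  obtain ⟨l, hl⟩ : ∃ l, l = p + δ := ⟨_, rfl⟩
  obtain rfl : α = A + 1 - x + m - p := by omega
  obtain rfl : γ = B + 1 - x - m + p := by omega
  obtain rfl : β = k - m := by omega
  obtain rfl : δ = l - p := by omega
  have hA0 : 0 ≤ A := by omega
  have hB0 : 0 ≤ B := by omega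
  have a1 := C_pascal A k hA0
  have a2 := C_pascal (A + 1) k (by omega)
  have a3 := C_pascal (A + 1) (k - 1) (by omega)
  have b1 := C_pascal B l hB0
  have b2 := C_pascal (B + 1) l (by omega)
  have b3 := C_pascal B (l - 1) hB0
  unfold f g h
  ring_nf at a1 a2 a3 b1 b2 b3 ⊢
  refine ⟨?_, ?_, ?_⟩ <;> grind
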